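/- arXiv:2604.27951 — 2 statements merged into one kernel-verified Lean document; each statement's English description precedes it below -/
import Mathlib

section
/- Assume the recurrence condition: μ₂ < 0 and r₊ < μ₁/μ₂ < r₋. Set α := (arctan(r₋) − arctan(r₊))/π and define G̃ : ℝ → ℂ by G̃(t) := exp(i·(α − 1)·(2·arctan(t) + π)) · G(t). Then G̃ is Lipschitz continuous on ℝ, i.e. there is a constant K ≥ 0 with |G̃(s) − G̃(t)| ≤ K·|s − t| for all s, t ∈ ℝ. -/
/-- The coefficient `G` of the Riemann boundary value problem:
`G(t) = −(r₋·i·t − μ₂ − √(μ₂² − 2μ₁·i·t + t²)) / (r₊·i·t − μ₂ − √(μ₂² − 2μ₁·i·t + t²))`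
for `t ≠ 0` (principal branch of the complex square root), and
`G(0) = −(μ₁ − r₋μ₂)/(μ₁ − r₊μ₂)`. Here `rp = r₊` and `rm = r₋`. -/
noncomputable def G (μ₁ μ₂ rp rm : ℝ) (t : ℝ) : ℂ :=
  if t = 0 then ((-((μ₁ - rm * μ₂) / (μ₁ - rp * μ₂)) : ℝ) : ℂ)
  else
    -(((rm : ℂ) * Complex.I * t - (μ₂ : ℂ) -
        ((μ₂ : ℂ) ^ 2 - 2 * μ₁ * Complex.I * t + (t : ℂ) ^ 2) ^ (1 / 2 : ℂ)) /
      ((rp : ℂ) * Complex.I * t - (μ₂ : ℂ) -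
        ((μ₂ : ℂ) ^ 2 - 2 * μ₁ * Complex.I * t + (t : ℂ) ^ 2) ^ (1 / 2 : ℂ)))

/-- Quotient of Lipschitz functions with controlled denominators. -/
lemma lip_div (N D : ℝ → ℂ) (hN : ∃ K : ℝ, 0 ≤ K ∧ ∀ s t : ℝ, ‖N s - N t‖ ≤ K * |s - t|)
    (hD : ∃ K : ℝ, 0 ≤ K ∧ ∀ s t : ℝ, ‖D s - D t‖ ≤ K * |s - t|)
    (c M : ℝ) (hc : 0 < c) (hM : 0 ≤ M) (hcD : ∀ t, c ≤ ‖D t‖) (hb : ∀ t, ‖N t‖ ≤ M * ‖D t‖) :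
    (∃ K : ℝ, 0 ≤ K ∧ ∀ s t : ℝ, ‖N s / D s - N t / D t‖ ≤ K * |s - t|) ∧
      (∃ B : ℝ, 0 ≤ B ∧ ∀ t, ‖N t / D t‖ ≤ B) := by
  obtain ⟨K, hK, hN⟩ := hN
  obtain ⟨L, hL, hD⟩ := hD
  have h0 : ∀ t, D t ≠ 0 := fun t h => by
    have := hcD t
    rw [h, norm_zero] at this
    linarith
  have hq : ∀ t, ‖N t / D t‖ ≤ M := fun t => by
    rw [norm_div, div_le_iff₀ (lt_of_lt_of_le hc (hcD t))]
    exact hb t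
  refine ⟨⟨(K + M * L) / c, by positivity, fun s t => ?_⟩, M, hM, hq⟩
  have e : N s / D s - N t / D t = ((N s - N t) - (N t / D t) * (D s - D t)) / D s := by
    have := h0 s
    have := h0 t
    field_simp
    ring
  rw [e, norm_div, div_le_iff₀ (lt_of_lt_of_le hc (hcD s))]
  have h1 : ‖(N s - N t) - (N t / D t) * (D s - D t)‖ ≤ K * |s - t| + M * (L * |s - t|) := by
    refine (norm_sub_le _ _).trans (add_le_add (hN s t) ?_)
    rw [norm_mul]
    exact mul_le_mul (hq t) (hD s t) (norm_nonneg _) hM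
  refine h1.trans ?_
  calc K * |s - t| + M * (L * |s - t|) = (K + M * L) / c * |s - t| * c := by
        field_simp
    _ ≤ _ := mul_le_mul_of_nonneg_left (hcD s) (by positivity)

lemma lip_mul (f g : ℝ → ℂ) (hf : ∃ K : ℝ, 0 ≤ K ∧ ∀ s t : ℝ, ‖f s - f t‖ ≤ K * |s - t|)
    (hf' : ∃ B : ℝ, 0 ≤ B ∧ ∀ t, ‖f t‖ ≤ B)
    (hg : ∃ K : ℝ, 0 ≤ K ∧ ∀ s t : ℝ, ‖g s - g t‖ ≤ K * |s - t|)
    (hg' : ∃ B : ℝ, 0 ≤ B ∧ ∀ t, ‖g t‖ ≤ B) :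
    (∃ K : ℝ, 0 ≤ K ∧ ∀ s t : ℝ, ‖f s * g s - f t * g t‖ ≤ K * |s - t|) ∧
      (∃ B : ℝ, 0 ≤ B ∧ ∀ t, ‖f t * g t‖ ≤ B) := by
  obtain ⟨K, hK, hf⟩ := hf
  obtain ⟨L, hL, hg⟩ := hg
  obtain ⟨A, hA, hf'⟩ := hf'
  obtain ⟨B, hB, hg'⟩ := hg'
  refine ⟨⟨K * B + A * L, by positivity, fun s t => ?_⟩, A * B, by positivity, fun t => ?_⟩
  · have e : f s * g s - f t * g t = (f s - f t) * g s + f t * (g s - g t) := by ring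
    rw [e]
    refine (norm_add_le _ _).trans ?_
    rw [norm_mul, norm_mul]
    have h1 := mul_le_mul (hf s t) (hg' s) (norm_nonneg _) (by positivity)
    have h2 := mul_le_mul (hf' t) (hg s t) (norm_nonneg _) hA
    linarith
  · rw [norm_mul]
    exact mul_le_mul (hf' t) (hg' t) (norm_nonneg _) hA

/-- The square root appearing in `G`. -/
noncomputable def Sq (μ₁ μ₂ : ℝ) (t : ℝ) : ℂ :=
  ((μ₂ : ℂ) ^ 2 - 2 * μ₁ * Complex.I * t + (t : ℂ) ^ 2) ^ (1 / 2 : ℂ)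

lemma Sq_sq (μ₁ μ₂ t : ℝ) :
    Sq μ₁ μ₂ t ^ 2 = (μ₂ : ℂ) ^ 2 - 2 * μ₁ * Complex.I * t + (t : ℂ) ^ 2 := by
  unfold Sq
  rw [one_div]
  exact Complex.cpow_ofNat_inv_pow _ 2

lemma Sq_re (μ₁ μ₂ t : ℝ) : √(μ₂ ^ 2 + t ^ 2) ≤ (Sq μ₁ μ₂ t).re := by
  unfold Sq
  rw [one_div, Complex.cpow_inv_two_re]
  apply Real.sqrt_le_sqrt
  have h : ((μ₂ : ℂ) ^ 2 - 2 * μ₁ * Complex.I * t + (t : ℂ) ^ 2).re = μ₂ ^ 2 + t ^ 2 := by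
    simp [pow_two]
  have h2 := Complex.re_le_norm ((μ₂ : ℂ) ^ 2 - 2 * μ₁ * Complex.I * t + (t : ℂ) ^ 2)
  rw [h] at *
  linarith

lemma Sq_re_t (μ₁ μ₂ t : ℝ) : |t| ≤ (Sq μ₁ μ₂ t).re :=
  (Real.abs_le_sqrt (by nlinarith)).trans (Sq_re μ₁ μ₂ t)

lemma Sq_re_m (μ₁ μ₂ t : ℝ) : |μ₂| ≤ (Sq μ₁ μ₂ t).re :=
  (Real.abs_le_sqrt (by nlinarith)).trans (Sq_re μ₁ μ₂ t)

lemma Sq_lip (μ₁ μ₂ : ℝ) (h : μ₂ < 0) (s t : ℝ) :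
    ‖Sq μ₁ μ₂ s - Sq μ₁ μ₂ t‖ ≤ (1 + |μ₁| / |μ₂|) * |s - t| := by
  have hm : 0 < |μ₂| := abs_pos.2 h.ne
  have e : (Sq μ₁ μ₂ s - Sq μ₁ μ₂ t) * (Sq μ₁ μ₂ s + Sq μ₁ μ₂ t) =
      ((s - t : ℝ) : ℂ) * (((s : ℝ) : ℂ) + ((t : ℝ) : ℂ) + ((-(2 * μ₁) : ℝ) : ℂ) * Complex.I) := by
    have h1 := Sq_sq μ₁ μ₂ s
    have h2 := Sq_sq μ₁ μ₂ t
    push_cast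
    linear_combination h1 - h2
  have hr := Complex.re_le_norm (Sq μ₁ μ₂ s + Sq μ₁ μ₂ t)
  rw [Complex.add_re] at hr
  have a1 := Sq_re_t μ₁ μ₂ s
  have a2 := Sq_re_t μ₁ μ₂ t
  have a3 := Sq_re_m μ₁ μ₂ s
  have a4 := Sq_re_m μ₁ μ₂ t
  have hn := congrArg norm e
  rw [norm_mul, norm_mul, Complex.norm_real, Real.norm_eq_abs] at hn
  set P := ‖Sq μ₁ μ₂ s + Sq μ₁ μ₂ t‖
  have hP : 0 < P := by linarith
  have hb : ‖((s : ℝ) : ℂ) + ((t : ℝ) : ℂ) + ((-(2 * μ₁) : ℝ) : ℂ) * Complex.I‖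
      ≤ (1 + |μ₁| / |μ₂|) * P := by
    refine (norm_add₃_le).trans ?_
    rw [norm_mul, Complex.norm_I, Complex.norm_real, Complex.norm_real, Complex.norm_real]
    simp only [Real.norm_eq_abs, abs_neg, abs_mul, abs_two, mul_one]
    have : 2 * |μ₁| ≤ |μ₁| / |μ₂| * P := by
      calc 2 * |μ₁| = |μ₁| / |μ₂| * (2 * |μ₂|) := by field_simp
        _ ≤ _ := mul_le_mul_of_nonneg_left (by linarith) (by positivity)
    linarith
  refine le_of_mul_le_mul_right ?_ hP
  rw [hn]
  calc _ ≤ |s - t| * ((1 + |μ₁| / |μ₂|) * P) := mul_le_mul_of_nonneg_left hb (abs_nonneg _)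
    _ = _ := by ring

/-- Conjugate factor. -/
noncomputable def Cj (μ₁ μ₂ r : ℝ) (t : ℝ) : ℂ := (r : ℂ) * Complex.I * t - μ₂ + Sq μ₁ μ₂ t

/-- Linear factor. -/
noncomputable def Ln (μ₁ μ₂ r : ℝ) (t : ℝ) : ℂ :=
  2 * Complex.I * ((μ₁ - r * μ₂ : ℝ) : ℂ) - ((1 + r ^ 2 : ℝ) : ℂ) * t

lemma Cj_lb (μ₁ μ₂ r t : ℝ) : |t| - μ₂ ≤ ‖Cj μ₁ μ₂ r t‖ := by
  refine le_trans ?_ (Complex.re_le_norm _)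
  have := Sq_re_t μ₁ μ₂ t
  simp [Cj]
  linarith

lemma Cj_lip (μ₁ μ₂ r : ℝ) (h : μ₂ < 0) :
    ∃ K : ℝ, 0 ≤ K ∧ ∀ s t : ℝ, ‖Cj μ₁ μ₂ r s - Cj μ₁ μ₂ r t‖ ≤ K * |s - t| := by
  refine ⟨|r| + (1 + |μ₁| / |μ₂|), by positivity, fun s t => ?_⟩
  have e : Cj μ₁ μ₂ r s - Cj μ₁ μ₂ r t =
      (r : ℂ) * Complex.I * ((s - t : ℝ) : ℂ) + (Sq μ₁ μ₂ s - Sq μ₁ μ₂ t) := by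
    unfold Cj
    push_cast
    ring
  rw [e, add_mul]
  refine (norm_add_le _ _).trans (add_le_add (le_of_eq ?_) (Sq_lip μ₁ μ₂ h s t))
  rw [norm_mul, norm_mul, Complex.norm_I, Complex.norm_real, Complex.norm_real]
  simp

lemma Ln_lip (μ₁ μ₂ r : ℝ) :
    ∃ K : ℝ, 0 ≤ K ∧ ∀ s t : ℝ, ‖Ln μ₁ μ₂ r s - Ln μ₁ μ₂ r t‖ ≤ K * |s - t| := by
  refine ⟨|1 + r ^ 2|, by positivity, fun s t => ?_⟩
  have e : Ln μ₁ μ₂ r s - Ln μ₁ μ₂ r t = ((-((1 + r ^ 2) * (s - t)) : ℝ) : ℂ) := by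
    unfold Ln
    push_cast
    ring
  rw [e, Complex.norm_real, Real.norm_eq_abs, abs_neg, abs_mul]

lemma Ln_lb1 (μ₁ μ₂ r t : ℝ) : |t| ≤ ‖Ln μ₁ μ₂ r t‖ := by
  refine le_trans ?_ (Complex.abs_re_le_norm _)
  have : (Ln μ₁ μ₂ r t).re = -((1 + r ^ 2) * t) := by
    simp [Ln, -Complex.ofReal_add, -Complex.ofReal_sub]
  rw [this, abs_neg, abs_mul, abs_of_pos (by positivity : 0 < 1 + r ^ 2)]
  nlinarith [sq_nonneg r, abs_nonneg t, mul_nonneg (sq_nonneg r) (abs_nonneg t)]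

lemma Ln_lb2 (μ₁ μ₂ r t : ℝ) : 2 * |μ₁ - r * μ₂| ≤ ‖Ln μ₁ μ₂ r t‖ := by
  refine le_trans ?_ (Complex.abs_im_le_norm _)
  have : (Ln μ₁ μ₂ r t).im = 2 * (μ₁ - r * μ₂) := by
    simp [Ln, -Complex.ofReal_add, -Complex.ofReal_sub]
  rw [this, abs_mul, abs_two]

lemma key (μ₁ μ₂ r t : ℝ) :
    ((r : ℂ) * Complex.I * t - (μ₂ : ℂ) - Sq μ₁ μ₂ t) * Cj μ₁ μ₂ r t = t * Ln μ₁ μ₂ r t := by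
  have h1 := Sq_sq μ₁ μ₂ t
  unfold Cj Ln
  push_cast
  linear_combination -h1 + (r : ℂ) ^ 2 * t ^ 2 * Complex.I_sq

lemma G_eq (μ₁ μ₂ rp rm : ℝ) (h₂ : μ₂ < 0) (hc : μ₁ - rp * μ₂ ≠ 0) (t : ℝ) :
    G μ₁ μ₂ rp rm t =
      -1 * ((Ln μ₁ μ₂ rm t / Ln μ₁ μ₂ rp t) * (Cj μ₁ μ₂ rp t / Cj μ₁ μ₂ rm t)) := by
  have hC : ∀ r, Cj μ₁ μ₂ r t ≠ 0 := fun r h => by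
    have := Cj_lb μ₁ μ₂ r t
    rw [h, norm_zero] at this
    linarith [abs_nonneg t]
  have hL : Ln μ₁ μ₂ rp t ≠ 0 := fun h => by
    have := Ln_lb2 μ₁ μ₂ rp t
    rw [h, norm_zero] at this
    linarith [abs_pos.2 hc]
  have hp := hC rp
  have hm := hC rm
  by_cases ht : t = 0
  · have e : Cj μ₁ μ₂ rp t = Cj μ₁ μ₂ rm t := by simp [Cj, ht]
    rw [e, div_self hm]
    have hc' : ((μ₁ - rp * μ₂ : ℝ) : ℂ) ≠ 0 := by exact_mod_cast hc
    have : Ln μ₁ μ₂ rm t / Ln μ₁ μ₂ rp t = (((μ₁ - rm * μ₂) / (μ₁ - rp * μ₂) : ℝ) : ℂ) := by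
      rw [div_eq_iff hL, Complex.ofReal_div]
      simp only [Ln, ht, Complex.ofReal_zero, mul_zero, sub_zero]
      generalize ((μ₁ - rp * μ₂ : ℝ) : ℂ) = z at hc' ⊢
      field_simp
    rw [this]
    simp [G, ht]
  · have kp := key μ₁ μ₂ rp t
    have km := key μ₁ μ₂ rm t
    have ht' : (t : ℂ) ≠ 0 := by exact_mod_cast ht
    have hA := eq_div_of_mul_eq hp kp
    have hB := eq_div_of_mul_eq hm km
    have : G μ₁ μ₂ rp rm t = -(((rm : ℂ) * Complex.I * t - (μ₂ : ℂ) - Sq μ₁ μ₂ t) /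
        ((rp : ℂ) * Complex.I * t - (μ₂ : ℂ) - Sq μ₁ μ₂ t)) := by
      simp only [G, if_neg ht, Sq]
    rw [this, hA, hB]
    field_simp

lemma arctan_lip (s t : ℝ) : |Real.arctan s - Real.arctan t| ≤ |s - t| := by
  have := (convex_univ (𝕜 := ℝ) (E := ℝ)).norm_image_sub_le_of_norm_deriv_le
    (f := Real.arctan) (C := 1) (x := t) (y := s)
    (fun x _ => Real.differentiable_arctan x)
    (fun x _ => by
      rw [Real.deriv_arctan, Real.norm_eq_abs, abs_of_pos (by positivity)]
      rw [div_le_one (by positivity)]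
      nlinarith [sq_nonneg x]) trivial trivial
  simpa using this

lemma exp_lip (x y : ℝ) : ‖Complex.exp (Complex.I * x) - Complex.exp (Complex.I * y)‖ ≤ |x - y| := by
  have e : Complex.exp (Complex.I * x) - Complex.exp (Complex.I * y) =
      Complex.exp (Complex.I * y) * (Complex.exp (Complex.I * ((x - y : ℝ) : ℂ)) - 1) := by
    rw [mul_sub, ← Complex.exp_add]
    push_cast
    ring_nf
  rw [e, norm_mul, mul_comm Complex.I (y : ℂ), Complex.norm_exp_ofReal_mul_I, one_mul]
  simpa using Real.norm_exp_I_mul_ofReal_sub_one_le (x := x - y)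

/-- Under the recurrence condition, with `α = (arctan r₋ − arctan r₊)/π` and
`G̃(t) = exp(i(α−1)(2 arctan t + π)) · G(t)`, the corrected coefficient `G̃` is
Lipschitz continuous on `ℝ`. -/
theorem corrected_G_lipschitz (μ₁ μ₂ rp rm : ℝ) (h₂ : μ₂ < 0)
    (hp : rp < μ₁ / μ₂) (hm : μ₁ / μ₂ < rm)
    (α : ℝ) (hα : α = (Real.arctan rm - Real.arctan rp) / Real.pi)
    (Gt : ℝ → ℂ)
    (hGt : ∀ t : ℝ, Gt t =
      Complex.exp (Complex.I * (α - 1) * (2 * Real.arctan t + Real.pi)) *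
        G μ₁ μ₂ rp rm t) :
    ∃ K : ℝ, 0 ≤ K ∧ ∀ s t : ℝ, ‖Gt s - Gt t‖ ≤ K * |s - t| := by
  have hc : μ₁ - rp * μ₂ < 0 := by
    have := (lt_div_iff_of_neg h₂).1 hp
    linarith
  have hcp : 0 < |μ₁ - rp * μ₂| := abs_pos.2 hc.ne
  have Q1 := lip_div (Ln μ₁ μ₂ rm) (Ln μ₁ μ₂ rp) (Ln_lip _ _ _) (Ln_lip _ _ _)
    (2 * |μ₁ - rp * μ₂|) (|μ₁ - rm * μ₂| / |μ₁ - rp * μ₂| + (1 + rm ^ 2))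
    (by positivity) (by positivity) (Ln_lb2 _ _ _) (fun t => by
      have a1 := Ln_lb1 μ₁ μ₂ rp t
      have a2 := Ln_lb2 μ₁ μ₂ rp t
      have b1 : ‖Ln μ₁ μ₂ rm t‖ ≤ 2 * |μ₁ - rm * μ₂| + (1 + rm ^ 2) * |t| := by
        unfold Ln
        refine (norm_sub_le _ _).trans ?_
        rw [norm_mul, norm_mul, norm_mul, Complex.norm_I, Complex.norm_real, Complex.norm_real,
          Complex.norm_real]
        simp only [Real.norm_eq_abs, abs_of_pos (by positivity : 0 < 1 + rm ^ 2)]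
        simp
      have b2 : 2 * |μ₁ - rm * μ₂| ≤ |μ₁ - rm * μ₂| / |μ₁ - rp * μ₂| * ‖Ln μ₁ μ₂ rp t‖ := by
        calc 2 * |μ₁ - rm * μ₂|
            = |μ₁ - rm * μ₂| / |μ₁ - rp * μ₂| * (2 * |μ₁ - rp * μ₂|) := by
              clear a2
              generalize |μ₁ - rp * μ₂| = z at hcp ⊢
              field_simp
          _ ≤ _ := mul_le_mul_of_nonneg_left a2 (by positivity)
      have b3 := mul_le_mul_of_nonneg_left a1 (by positivity : 0 ≤ 1 + rm ^ 2)
      linarith)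
  have Q2 := lip_div (Cj μ₁ μ₂ rp) (Cj μ₁ μ₂ rm) (Cj_lip _ _ _ h₂) (Cj_lip _ _ _ h₂)
    (-μ₂) (1 + |rp - rm|) (by linarith) (by positivity)
    (fun t => by linarith [Cj_lb μ₁ μ₂ rm t, abs_nonneg t]) (fun t => by
      have a1 := Cj_lb μ₁ μ₂ rm t
      have e : Cj μ₁ μ₂ rp t = Cj μ₁ μ₂ rm t + ((rp - rm : ℝ) : ℂ) * Complex.I * t := by
        unfold Cj
        push_cast
        ring
      have b1 : ‖Cj μ₁ μ₂ rp t‖ ≤ ‖Cj μ₁ μ₂ rm t‖ + |rp - rm| * |t| := by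
        rw [e]
        refine (norm_add_le _ _).trans (le_of_eq ?_)
        rw [norm_mul, norm_mul, Complex.norm_I, Complex.norm_real, Complex.norm_real]
        simp
      have b2 := mul_le_mul_of_nonneg_left (by linarith : |t| ≤ ‖Cj μ₁ μ₂ rm t‖)
        (abs_nonneg (rp - rm))
      linarith)
  have Q3 := lip_mul _ _ Q1.1 Q1.2 Q2.1 Q2.2
  have Q4 := lip_mul (fun _ => -1) _ ⟨0, le_rfl, fun s t => by simp⟩ ⟨1, zero_le_one, fun t => by simp⟩
    Q3.1 Q3.2
  have hE : ∀ t : ℝ, Complex.exp (Complex.I * (α - 1) * (2 * Real.arctan t + Real.pi)) =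
      Complex.exp (Complex.I * (((α - 1) * (2 * Real.arctan t + Real.pi) : ℝ) : ℂ)) := fun t => by
    push_cast
    ring_nf
  have Q5 := lip_mul
    (fun t => Complex.exp (Complex.I * (((α - 1) * (2 * Real.arctan t + Real.pi) : ℝ) : ℂ))) _
    ⟨|α - 1| * 2, by positivity, fun s t => by
      refine (exp_lip _ _).trans ?_
      rw [← mul_sub, abs_mul, mul_assoc]
      refine mul_le_mul_of_nonneg_left ?_ (abs_nonneg _)
      rw [show 2 * Real.arctan s + Real.pi - (2 * Real.arctan t + Real.pi)
        = 2 * (Real.arctan s - Real.arctan t) by ring, abs_mul, abs_two]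
      linarith [arctan_lip s t]⟩
    ⟨1, zero_le_one, fun t => by
      rw [mul_comm Complex.I, Complex.norm_exp_ofReal_mul_I]⟩ Q4.1 Q4.2
  obtain ⟨K, hK, h⟩ := Q5.1
  refine ⟨K, hK, fun s t => ?_⟩
  rw [hGt s, hGt t, hE, hE, G_eq μ₁ μ₂ rp rm h₂ hc.ne, G_eq μ₁ μ₂ rp rm h₂ hc.ne]
  exact h s t
end

section
/- For every complex number a with Re(a) > 0, the integral over ω ∈ (0, ∞) of exp(−a·ω² − conj(a)/ω²) equals (√π/2) · exp(−2·|a|) / √a, where √a is the principal square root of a and |a| its modulus. -/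
open MeasureTheory

/-- The entire function whose horizontal integrals are constant. -/
noncomputable def gtiF (r : ℝ) (z : ℂ) : ℂ :=
  Complex.exp (-(2 * r) * Complex.cosh (2 * z)) * Complex.exp z

/-- Its derivative. -/
noncomputable def gtiF' (r : ℝ) (z : ℂ) : ℂ :=
  (1 - 4 * r * Complex.sinh (2 * z)) * gtiF r z

lemma gtiF_hasDerivAt (r : ℝ) (z : ℂ) : HasDerivAt (gtiF r) (gtiF' r z) z := by
  have h2 : HasDerivAt (fun z : ℂ => 2 * z) 2 z := by
    simpa using (hasDerivAt_id z).const_mul (2 : ℂ)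
  have h1 : HasDerivAt (fun z : ℂ => Complex.cosh (2 * z)) (Complex.sinh (2 * z) * 2) z :=
    (Complex.hasDerivAt_cosh (2 * z)).comp z h2
  have h3 := ((h1.const_mul (-(2 * r : ℂ))).cexp).mul (Complex.hasDerivAt_exp z)
  refine h3.congr_deriv ?_
  unfold gtiF' gtiF
  ring

lemma gti_continuous (r : ℝ) : Continuous (gtiF r) := by
  unfold gtiF; fun_prop

lemma gti_continuous' (r : ℝ) : Continuous (gtiF' r) := by
  unfold gtiF' gtiF; fun_prop

lemma gti_cosh_re (u t : ℝ) :
    (Complex.cosh (2 * ((u : ℂ) + t * Complex.I))).re = Real.cosh (2 * u) * Real.cos (2 * t) := by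
  have : (2 * ((u : ℂ) + t * Complex.I)) = ((2 * u : ℝ) : ℂ) + ((2 * t : ℝ) : ℂ) * Complex.I := by
    push_cast; ring
  rw [this, Complex.cosh_add, Complex.cosh_mul_I, Complex.sinh_mul_I, ← Complex.ofReal_cosh,
    ← Complex.ofReal_sinh, ← Complex.ofReal_cos, ← Complex.ofReal_sin]
  simp [-Complex.ofReal_cosh, -Complex.ofReal_sinh, -Complex.ofReal_cos, -Complex.ofReal_sin,
    -Complex.ofReal_mul]

lemma gti_sinh_norm (w : ℂ) : ‖Complex.sinh w‖ ≤ Real.cosh w.re := by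
  have : Complex.sinh w = (Complex.exp w - Complex.exp (-w)) / 2 := rfl
  rw [this, norm_div, Real.cosh_eq]
  have := norm_sub_le (Complex.exp w) (Complex.exp (-w))
  rw [Complex.norm_exp, Complex.norm_exp, Complex.neg_re] at this
  simp only [Complex.norm_ofNat]
  linarith

lemma gti_cosh_lower (u : ℝ) : 1 + u ^ 2 ≤ Real.cosh (2 * u) := by
  rw [Real.cosh_two_mul, Real.cosh_sq]
  have h : |u| ≤ |Real.sinh u| := by
    rw [Real.abs_sinh]
    exact Real.self_le_sinh_iff.2 (abs_nonneg u)
  have := sq_le_sq.2 h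
  nlinarith [sq_nonneg u]

lemma gti_exp_le (u : ℝ) : Real.exp u ≤ 3 * Real.cosh (2 * u) := by
  have h1 : Real.exp u ≤ 1 + Real.exp u ^ 2 := by nlinarith [sq_nonneg (Real.exp u - 1)]
  have h2 : Real.exp u ^ 2 = Real.exp (2 * u) := by rw [← Real.exp_nat_mul]; norm_num
  have h3 := Real.cosh_eq (2 * u)
  have h4 := Real.exp_pos (-(2 * u))
  have h5 := gti_cosh_lower u
  nlinarith [sq_nonneg u]

/-- the constant in the bound -/
noncomputable def gtiC (r c : ℝ) : ℝ := (1 + 4 * r) * 18 / (2 * r * c) ^ 3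

lemma gti_real_bound (r c u : ℝ) (hr : 0 < r) (hc : 0 < c) :
    (1 + 4 * r * Real.cosh (2 * u)) * (Real.exp (-(2 * r * c * Real.cosh (2 * u))) * Real.exp u)
      ≤ gtiC r c * (1 + u ^ 2)⁻¹ := by
  have hx := gti_cosh_lower u
  have he := gti_exp_le u
  set x := Real.cosh (2 * u)
  have hx1 : 1 ≤ x := by nlinarith [sq_nonneg u]
  have hx0 : 0 < x := by linarith
  have hk : 0 < 2 * r * c := by positivity
  have h3 : (2 * r * c * x) ^ 3 / 6 ≤ Real.exp (2 * r * c * x) := by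
    have := Real.pow_div_factorial_le_exp (2 * r * c * x) (by positivity) 3
    simpa [Nat.factorial] using this
  have h4 : Real.exp (-(2 * r * c * x)) ≤ 6 / (2 * r * c * x) ^ 3 := by
    rw [Real.exp_neg, inv_le_comm₀ (Real.exp_pos _) (by positivity), inv_div]
    exact h3
  have h5 : 1 + 4 * r * x ≤ (1 + 4 * r) * x := by nlinarith
  calc (1 + 4 * r * x) * (Real.exp (-(2 * r * c * x)) * Real.exp u)
      ≤ ((1 + 4 * r) * x) * ((6 / (2 * r * c * x) ^ 3) * (3 * x)) := by gcongr
    _ = gtiC r c * x⁻¹ := by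
        unfold gtiC
        field_simp
        ring
    _ ≤ gtiC r c * (1 + u ^ 2)⁻¹ := by
        have : 0 ≤ gtiC r c := by unfold gtiC; positivity
        gcongr

lemma gti_norm_F (r c u t : ℝ) (hr : 0 < r) (hct : c ≤ Real.cos (2 * t)) :
    ‖gtiF r (u + t * Complex.I)‖
      ≤ Real.exp (-(2 * r * c * Real.cosh (2 * u))) * Real.exp u := by
  unfold gtiF
  rw [norm_mul, Complex.norm_exp, Complex.norm_exp]
  have h1 : (-(2 * (r : ℂ)) * Complex.cosh (2 * ((u : ℂ) + t * Complex.I))).re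
      = -(2 * r * Real.cos (2 * t) * Real.cosh (2 * u)) := by
    have : (-(2 * (r : ℂ))) = ((-(2 * r) : ℝ) : ℂ) := by push_cast; ring
    rw [this, Complex.re_ofReal_mul, gti_cosh_re]; ring
  have h2 : ((u : ℂ) + t * Complex.I).re = u := by simp
  rw [h1, h2]
  have := Real.cosh_pos (2 * u)
  gcongr

lemma gti_bound' (r c u t : ℝ) (hr : 0 < r) (hc : 0 < c) (hct : c ≤ Real.cos (2 * t)) :
    ‖gtiF' r (u + t * Complex.I)‖ ≤ gtiC r c * (1 + u ^ 2)⁻¹ := by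
  refine le_trans ?_ (gti_real_bound r c u hr hc)
  unfold gtiF'
  rw [norm_mul]
  have h := gti_norm_F r c u t hr hct
  have h2 : ‖1 - 4 * (r : ℂ) * Complex.sinh (2 * ((u : ℂ) + t * Complex.I))‖
      ≤ 1 + 4 * r * Real.cosh (2 * u) := by
    refine (norm_sub_le _ _).trans ?_
    have h3 := gti_sinh_norm (2 * ((u : ℂ) + t * Complex.I))
    have h4 : (2 * ((u : ℂ) + t * Complex.I)).re = 2 * u := by simp
    rw [h4] at h3
    simp only [norm_one, norm_mul, Complex.norm_ofNat, Complex.norm_real, Real.norm_eq_abs,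
      abs_of_pos hr] at h3 ⊢
    gcongr
  have := Real.cosh_pos (2 * u)
  exact mul_le_mul h2 h (norm_nonneg _) (by positivity)

lemma gti_bound (r c u t : ℝ) (hr : 0 < r) (hc : 0 < c) (hct : c ≤ Real.cos (2 * t)) :
    ‖gtiF r (u + t * Complex.I)‖ ≤ gtiC r c * (1 + u ^ 2)⁻¹ := by
  refine le_trans ?_ (gti_real_bound r c u hr hc)
  refine (gti_norm_F r c u t hr hct).trans ?_
  have := Real.cosh_pos (2 * u)
  refine le_mul_of_one_le_left (by positivity) ?_
  have : 0 < 4 * r * Real.cosh (2 * u) := by positivity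
  linarith

lemma gti_bound_integrable (C : ℝ) : Integrable fun u : ℝ => C * (1 + u ^ 2)⁻¹ :=
  integrable_inv_one_add_sq.const_mul C

lemma gti_int (r t : ℝ) (hr : 0 < r) (ht : 0 < Real.cos (2 * t)) :
    Integrable fun u : ℝ => gtiF r (u + t * Complex.I) := by
  refine (gti_bound_integrable (gtiC r (Real.cos (2 * t)))).mono' ?_ ?_
  · exact ((gti_continuous r).comp (by fun_prop)).aestronglyMeasurable
  · exact Filter.Eventually.of_forall fun u => gti_bound r _ u t hr ht le_rfl

lemma gti_int' (r t : ℝ) (hr : 0 < r) (ht : 0 < Real.cos (2 * t)) :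
    Integrable fun u : ℝ => gtiF' r (u + t * Complex.I) := by
  refine (gti_bound_integrable (gtiC r (Real.cos (2 * t)))).mono' ?_ ?_
  · exact ((gti_continuous' r).comp (by fun_prop)).aestronglyMeasurable
  · exact Filter.Eventually.of_forall fun u => gti_bound' r _ u t hr ht le_rfl

lemma gti_deriv_u (r u t : ℝ) :
    HasDerivAt (fun u : ℝ => gtiF r (u + t * Complex.I)) (gtiF' r (u + t * Complex.I)) u := by
  have h1 : HasDerivAt (fun u : ℝ => (u : ℂ) + t * Complex.I) 1 u :=
    (Complex.ofRealCLM.hasDerivAt (x := u)).add_const _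
  simpa [Function.comp_def] using
    HasDerivAt.comp u (gtiF_hasDerivAt r (u + t * Complex.I)) h1

lemma gti_deriv_t (r u t : ℝ) :
    HasDerivAt (fun t : ℝ => gtiF r (u + t * Complex.I))
      (gtiF' r (u + t * Complex.I) * Complex.I) t := by
  have h0 : HasDerivAt (fun t : ℝ => (t : ℂ)) 1 t := Complex.ofRealCLM.hasDerivAt (x := t)
  have h1 : HasDerivAt (fun t : ℝ => (u : ℂ) + t * Complex.I) Complex.I t := by
    simpa using (h0.mul_const Complex.I).const_add (u : ℂ)
  simpa [Function.comp_def] using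
    HasDerivAt.comp t (gtiF_hasDerivAt r (u + t * Complex.I)) h1

lemma gti_zero (r t : ℝ) (hr : 0 < r) (ht : 0 < Real.cos (2 * t)) :
    ∫ u : ℝ, gtiF' r (u + t * Complex.I) = 0 := by
  have hlim : ∀ l : Filter ℝ, Filter.Tendsto (fun u : ℝ => u ^ 2) l Filter.atTop →
      Filter.Tendsto (fun u : ℝ => gtiF r (u + t * Complex.I)) l (nhds 0) := by
    intro l hl
    refine squeeze_zero_norm (fun u => gti_bound r _ u t hr ht le_rfl) ?_
    have := (Filter.tendsto_atTop_add_const_left l 1 hl).inv_tendsto_atTop.const_mul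
      (gtiC r (Real.cos (2 * t)))
    simpa using this
  have := integral_of_hasDerivAt_of_tendsto (fun u => gti_deriv_u r u t) (gti_int' r t hr ht)
    (hlim _ (by
      simpa [Function.comp_def] using
        (Filter.tendsto_pow_atTop (α := ℝ) (n := 2) (by norm_num)).comp
          Filter.tendsto_neg_atBot_atTop))
    (hlim _ (Filter.tendsto_pow_atTop (by norm_num)))
  simpa using this

lemma gti_hasDerivAt_int (r t : ℝ) (hr : 0 < r) (ht : 0 < Real.cos (2 * t)) :
    HasDerivAt (fun t : ℝ => ∫ u : ℝ, gtiF r (u + t * Complex.I)) 0 t := by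
  have hs : {s : ℝ | Real.cos (2 * t) / 2 < Real.cos (2 * s)} ∈ nhds t := by
    refine IsOpen.mem_nhds (isOpen_lt (by fun_prop) (by fun_prop)) ?_
    change Real.cos (2 * t) / 2 < Real.cos (2 * t)
    linarith
  have := hasDerivAt_integral_of_dominated_loc_of_deriv_le (μ := volume)
    (F := fun (t : ℝ) (u : ℝ) => gtiF r (u + t * Complex.I))
    (F' := fun (t : ℝ) (u : ℝ) => gtiF' r (u + t * Complex.I) * Complex.I)
    (bound := fun u => gtiC r (Real.cos (2 * t) / 2) * (1 + u ^ 2)⁻¹) (x₀ := t) hs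
    (Filter.Eventually.of_forall fun s =>
      ((gti_continuous r).comp (by fun_prop)).aestronglyMeasurable)
    (gti_int r t hr ht) ((gti_int' r t hr ht).mul_const _).aestronglyMeasurable
    (Filter.Eventually.of_forall fun u s hs => by
      rw [norm_mul, Complex.norm_I, mul_one]
      exact gti_bound' r _ u s hr (by linarith) (le_of_lt hs))
    (gti_bound_integrable _)
    (Filter.Eventually.of_forall fun u s hs => gti_deriv_t r u s)
  have h2 := this.2
  rwa [integral_mul_const, gti_zero r t hr ht, zero_mul] at h2

lemma gti_const (r t : ℝ) (hr : 0 < r) (ht : |t| < Real.pi / 4) :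
    ∫ u : ℝ, gtiF r (u + t * Complex.I) = ∫ u : ℝ, gtiF r u := by
  have hd : ∀ s ∈ Set.Ioo (-(Real.pi / 4)) (Real.pi / 4), HasDerivAt
      (fun t : ℝ => ∫ u : ℝ, gtiF r (u + t * Complex.I)) 0 s := fun s hs =>
    gti_hasDerivAt_int r s hr (Real.cos_pos_of_mem_Ioo ⟨by linarith [hs.1], by linarith [hs.2]⟩)
  have := isOpen_Ioo.is_const_of_deriv_eq_zero isPreconnected_Ioo
    (fun s hs => (hd s hs).differentiableAt.differentiableWithinAt)
    (fun s hs => (hd s hs).deriv) (abs_lt.1 ht)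
    (show (0 : ℝ) ∈ Set.Ioo (-(Real.pi / 4)) (Real.pi / 4) by
      constructor <;> linarith [Real.pi_pos])
  simpa using this

lemma gti_real (r : ℝ) (hr : 0 < r) :
    ∫ u : ℝ, gtiF r u = ((Real.exp (-2 * r) * Real.sqrt (Real.pi / (4 * r)) : ℝ) : ℂ) := by
  have hint : Integrable fun u : ℝ => gtiF r u := by
    simpa using gti_int r 0 hr (by simp)
  have hneg : ∫ u : ℝ, gtiF r ((-u : ℝ) : ℂ) = ∫ u : ℝ, gtiF r u :=
    integral_neg_eq_self (fun u : ℝ => gtiF r u) volume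
  have hsub : ∫ x : ℝ, Real.exp (-(4 * r) * x ^ 2)
      = ∫ u : ℝ, Real.cosh u * Real.exp (-(4 * r) * Real.sinh u ^ 2) := by
    have := integral_image_eq_integral_abs_deriv_smul (s := Set.univ) MeasurableSet.univ
      (fun x _ => (Real.hasDerivAt_sinh x).hasDerivWithinAt) Real.sinh_injective.injOn
      (fun x => Real.exp (-(4 * r) * x ^ 2))
    rw [Set.image_univ, Real.sinh_surjective.range_eq] at this
    simpa [abs_of_pos (Real.cosh_pos _)] using this
  have hsum : (∫ u : ℝ, gtiF r u) + ∫ u : ℝ, gtiF r ((-u : ℝ) : ℂ)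
      = ∫ u : ℝ, ((2 * Real.exp (-2 * r) *
        (Real.cosh u * Real.exp (-(4 * r) * Real.sinh u ^ 2)) : ℝ) : ℂ) := by
    rw [← integral_add hint hint.comp_neg]
    refine integral_congr_ae (Filter.Eventually.of_forall fun u => ?_)
    have e1 : (2 * (Real.exp (-2 * r)) * (Real.cosh u * Real.exp (-(4 * r) * Real.sinh u ^ 2)))
        = Real.exp (-(2 * r) * Real.cosh (2 * u)) * (Real.exp u + Real.exp (-u)) := by
      have : Real.exp (-(2 * r) * Real.cosh (2 * u))
          = Real.exp (-2 * r) * Real.exp (-(4 * r) * Real.sinh u ^ 2) := by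
        rw [← Real.exp_add, Real.cosh_two_mul, Real.cosh_sq]; ring_nf
      rw [this, Real.cosh_eq]; ring
    beta_reduce
    rw [e1]
    simp only [gtiF]
    push_cast
    rw [mul_neg, Complex.cosh_neg]
    ring
  rw [hneg, integral_complex_ofReal, integral_const_mul, ← hsub, integral_gaussian] at hsum
  have h2 : (2 : ℂ) ≠ 0 := two_ne_zero
  apply mul_left_cancel₀ h2
  rw [two_mul, hsum]
  push_cast
  ring

/-- For every complex `a` with `Re a > 0`:
`∫_{(0,∞)} exp(−a ω² − conj(a)/ω²) dω = (√π/2) · exp(−2|a|)/√a`,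
where `√a` is the principal square root. -/
theorem gaussian_type_integral (a : ℂ) (ha : 0 < a.re) :
    ∫ ω in Set.Ioi (0 : ℝ),
        Complex.exp (-a * (ω : ℂ) ^ 2 - starRingEnd ℂ a / (ω : ℂ) ^ 2) =
      ((Real.sqrt Real.pi / 2 : ℝ) : ℂ) *
        Complex.exp (-2 * (‖a‖ : ℂ)) / a ^ (1 / 2 : ℂ) := by
  have ha0 : a ≠ 0 := by rintro rfl; simp at ha
  have hr : 0 < ‖a‖ := norm_pos_iff.2 ha0
  have hθ : |a.arg| < Real.pi / 2 := Complex.abs_arg_lt_pi_div_two_iff.2 (Or.inl ha)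
  set r := ‖a‖ with hrdef
  set θ := a.arg with hθdef
  have hpol : a = r * Complex.exp (θ * Complex.I) := (Complex.norm_mul_exp_arg_mul_I a).symm
  have hconj : starRingEnd ℂ a = r * Complex.exp (-(θ * Complex.I)) := by
    conv_lhs => rw [hpol]
    rw [map_mul, ← Complex.exp_conj]
    simp
  have hpow : a ^ (1 / 2 : ℂ) = (Real.sqrt r : ℂ) * Complex.exp ((θ / 2 : ℝ) * Complex.I) := by
    rw [Complex.cpow_def_of_ne_zero ha0]
    have : Complex.log a = (Real.log r : ℂ) + θ * Complex.I := rfl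
    rw [this, add_mul, Complex.exp_add, Real.sqrt_eq_rpow, Real.rpow_def_of_pos hr]
    push_cast
    congr 2
    ring
  have hsub : ∫ ω in Set.Ioi (0 : ℝ),
        Complex.exp (-a * (ω : ℂ) ^ 2 - starRingEnd ℂ a / (ω : ℂ) ^ 2)
      = ∫ u : ℝ, gtiF r (u + (θ / 2 : ℝ) * Complex.I)
          * Complex.exp (-((θ / 2 : ℝ) * Complex.I)) := by
    have := integral_image_eq_integral_abs_deriv_smul (s := Set.univ) MeasurableSet.univ
      (fun x _ => (Real.hasDerivAt_exp x).hasDerivWithinAt) Real.exp_injective.injOn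
      (fun ω : ℝ => Complex.exp (-a * (ω : ℂ) ^ 2 - starRingEnd ℂ a / (ω : ℂ) ^ 2))
    rw [Set.image_univ, Real.range_exp, setIntegral_univ] at this
    rw [this]
    refine integral_congr_ae (Filter.Eventually.of_forall fun u => ?_)
    simp only [gtiF]
    rw [abs_of_pos (Real.exp_pos u), Complex.real_smul, mul_assoc, ← Complex.exp_add,
      add_neg_cancel_right, Complex.ofReal_exp, mul_comm]
    congr 2
    have hc : Complex.cosh (2 * ((u : ℂ) + (θ / 2 : ℝ) * Complex.I))
        = (Complex.exp (θ * Complex.I) * Complex.exp u ^ 2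
          + Complex.exp (-(θ * Complex.I)) / Complex.exp u ^ 2) / 2 := by
      rw [Complex.cosh, div_eq_mul_inv (Complex.exp (-(θ * Complex.I))), ← Complex.exp_nat_mul,
        ← Complex.exp_neg, ← Complex.exp_add, ← Complex.exp_add]
      push_cast
      ring_nf
    rw [hc, hconj, hpol]
    ring
  rw [hsub, integral_mul_const, gti_const r (θ / 2) hr (by rw [abs_div]; norm_num; linarith),
    gti_real r hr, hpow, Complex.exp_neg]
  have hs : Real.sqrt (Real.pi / (4 * r)) = Real.sqrt Real.pi / 2 / Real.sqrt r := by
    rw [Real.sqrt_div Real.pi_pos.le, Real.sqrt_mul (by norm_num),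
      show (4 : ℝ) = 2 ^ 2 by norm_num, Real.sqrt_sq (by norm_num), div_div]
  rw [hs]
  push_cast
  have hsr : (Real.sqrt r : ℂ) ≠ 0 := by exact_mod_cast (Real.sqrt_pos.2 hr).ne'
  have := Complex.exp_ne_zero ((θ / 2 : ℂ) * Complex.I)
  field_simp
end
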